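/- arXiv:1603.03973 — 2 statements merged into one kernel-verified Lean document; each statement's English description precedes it below -/
import Mathlib

section
/- Let 1 < p < ∞ and let f : ℝ → ℝ be a convex differentiable function. Then for every a, b ∈ ℝ and every A, B ≥ 0 one has |a − b|^{p−2}(a − b)·[A·|f'(a)|^{p−2}f'(a) − B·|f'(b)|^{p−2}f'(b)] ≥ |f(a) − f(b)|^{p−2}(f(a) − f(b))·(A − B). -/
theorem abs_rpow_sub_two_mul_self_of_nonneg {p : ℝ} (hp : 1 < p) {t : ℝ} (ht : 0 ≤ t) :
    |t| ^ (p - 2) * t = t ^ (p - 1) := by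
  rcases ht.eq_or_lt with rfl | ht
  · rw [Real.zero_rpow (by linarith), mul_zero]
  · rw [abs_of_pos ht, ← Real.rpow_add_one ht.ne']
    congr 1
    ring

theorem monotone_abs_rpow_sub_two_mul_self {p : ℝ} (hp : 1 < p) :
    Monotone fun t : ℝ => |t| ^ (p - 2) * t := by
  have key : MonotoneOn (fun t : ℝ => |t| ^ (p - 2) * t) (Set.Ici 0) := by
    intro s hs t ht hst
    simp only [Set.mem_Ici] at hs ht
    simp only [abs_rpow_sub_two_mul_self_of_nonneg hp hs,
      abs_rpow_sub_two_mul_self_of_nonneg hp ht]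
    exact Real.rpow_le_rpow hs hst (by linarith)
  exact monotone_of_odd_of_monotoneOn_nonneg (fun t => by simp) key

theorem ConvexOn.sub_le_deriv_mul_sub {f : ℝ → ℝ} (hconv : ConvexOn ℝ Set.univ f)
    (hdiff : Differentiable ℝ f) (x y : ℝ) : f x - f y ≤ (x - y) * deriv f x := by
  rcases lt_trichotomy x y with h | rfl | h
  · have := hconv.deriv_le_slope (Set.mem_univ x) (Set.mem_univ y) h (hdiff x)
    rw [slope_def_field, le_div_iff₀ (sub_pos.2 h)] at this
    linarith
  · simp
  · have := hconv.slope_le_deriv (Set.mem_univ y) (Set.mem_univ x) h (hdiff x)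
    rw [slope_def_field, div_le_iff₀ (sub_pos.2 h)] at this
    linarith

/-- **Lemma 2.1 (Brasco–Parini type inequality).**
For `1 < p < ∞`, a convex differentiable `f : ℝ → ℝ`, all `a b : ℝ` and all `A B ≥ 0`,
`|a − b|^{p−2}(a − b)·[A·|f'(a)|^{p−2}f'(a) − B·|f'(b)|^{p−2}f'(b)|
  ≥ |f(a) − f(b)|^{p−2}(f(a) − f(b))·(A − B)`.
Here `x ^ y` is the real power, so `|t|^{p-2} t = 0` when `t = 0`. -/
theorem brasco_parini_convex_inequality
    (p : ℝ) (hp : 1 < p)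
    (f : ℝ → ℝ) (hconv : ConvexOn ℝ Set.univ f) (hdiff : Differentiable ℝ f)
    (a b A B : ℝ) (hA : 0 ≤ A) (hB : 0 ≤ B) :
    |f a - f b| ^ (p - 2) * (f a - f b) * (A - B) ≤
      |a - b| ^ (p - 2) * (a - b) *
        (A * |deriv f a| ^ (p - 2) * deriv f a - B * |deriv f b| ^ (p - 2) * deriv f b) := by
  have hmono := monotone_abs_rpow_sub_two_mul_self hp
  have ha := hmono (hconv.sub_le_deriv_mul_sub hdiff a b)
  have hb := hmono (show (a - b) * deriv f b ≤ f a - f b by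
    linarith [hconv.sub_le_deriv_mul_sub hdiff b a])
  simp only [abs_mul, Real.mul_rpow (abs_nonneg _) (abs_nonneg _)] at ha hb
  have hA' := mul_le_mul_of_nonneg_left ha hA
  have hB' := mul_le_mul_of_nonneg_left hb hB
  linarith
end

section
/- Let 1 < p < ∞ and let g : ℝ → ℝ be a differentiable increasing function (g'(s) ≥ 0 for all s ∈ ℝ). Define G(t) = ∫₀^t g'(s)^{1/p} ds for t ∈ ℝ. Then for every a, b ∈ ℝ one has |a − b|^{p−2}(a − b)(g(a) − g(b)) ≥ |G(a) − G(b)|^p. -/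
open MeasureTheory in
/-- A differentiable function with nonnegative derivative has interval integrable derivative. -/
theorem intervalIntegrable_deriv_of_deriv_nonneg {g : ℝ → ℝ} (hdiff : Differentiable ℝ g)
    (hincr : ∀ s : ℝ, 0 ≤ deriv g s) (a b : ℝ) :
    IntervalIntegrable (deriv g) volume a b :=
  intervalIntegral.intervalIntegrable_deriv_of_nonneg hdiff.continuous.continuousOn
    (fun x _ => (hdiff x).hasDerivAt) (fun x _ => hincr x)

open MeasureTheory in
/-- Powers with exponent in `[0, 1]` preserve interval integrability of nonnegative functions. -/
theorem IntervalIntegrable.rpow_of_nonneg {f : ℝ → ℝ} {a b r : ℝ}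
    (hf : IntervalIntegrable f volume a b) (hf0 : ∀ s, 0 ≤ f s) (hr0 : 0 ≤ r) (hr1 : r ≤ 1) :
    IntervalIntegrable (fun s => f s ^ r) volume a b := by
  refine ((intervalIntegrable_const (c := (1 : ℝ))).add hf).mono_fun ?_ ?_
  · exact (hf.aestronglyMeasurable_restrict_uIoc.aemeasurable.pow_const r).aestronglyMeasurable
  · refine Filter.Eventually.of_forall fun s => ?_
    have h0 := hf0 s
    simp only [Real.norm_eq_abs]
    rw [abs_of_nonneg (by positivity), abs_of_nonneg (by positivity)]
    calc f s ^ r ≤ (1 + f s) ^ r := by gcongr; linarith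
      _ ≤ (1 + f s) ^ (1 : ℝ) := Real.rpow_le_rpow_of_exponent_le (by linarith) hr1
      _ = 1 + f s := Real.rpow_one _

open MeasureTheory in
/-- Jensen's inequality for the `p`-th root of a nonnegative function on an interval. -/
theorem integral_rpow_one_div_rpow_le {f : ℝ → ℝ} {a b p : ℝ} (hp : 1 < p) (hab : a < b)
    (hf : IntervalIntegrable f volume a b) (hf0 : ∀ s, 0 ≤ f s) :
    (∫ s in a..b, f s ^ (1 / p)) ^ p ≤ (b - a) ^ (p - 1) * ∫ s in a..b, f s := by
  have hp0 : 0 < p := by linarith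
  have hr0 : 0 ≤ 1 / p := by positivity
  have hr1 : 1 / p ≤ 1 := by rw [div_le_one hp0]; exact hp.le
  have hL : 0 < b - a := sub_pos.2 hab
  have hJ := (Real.concaveOn_rpow hr0 hr1).le_map_set_average
    (Real.continuous_rpow_const hr0).continuousOn isClosed_Ici
    (μ := volume) (t := Set.Ioc a b) (f := f) (by simp [hab]) (by simp)
    (Filter.Eventually.of_forall hf0)
    ((intervalIntegrable_iff_integrableOn_Ioc_of_le hab.le).1 hf)
    ((intervalIntegrable_iff_integrableOn_Ioc_of_le hab.le).1
      (hf.rpow_of_nonneg hf0 hr0 hr1))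
  rw [← Set.uIoc_of_le hab.le, interval_average_eq, interval_average_eq] at hJ
  simp only [smul_eq_mul] at hJ
  have hI : 0 ≤ ∫ s in a..b, f s ^ (1 / p) :=
    intervalIntegral.integral_nonneg hab.le fun s _ => Real.rpow_nonneg (hf0 s) _
  have hM : 0 ≤ ∫ s in a..b, f s := intervalIntegral.integral_nonneg hab.le fun s _ => hf0 s
  have hJp := Real.rpow_le_rpow (by positivity) hJ hp0.le
  rw [← Real.rpow_mul (by positivity), one_div_mul_cancel hp0.ne', Real.rpow_one,
    Real.mul_rpow (by positivity) hI, Real.inv_rpow hL.le,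
    inv_mul_le_iff₀ (by positivity)] at hJp
  rwa [← mul_assoc, ← div_eq_mul_inv, ← Real.rpow_sub_one hL.ne'] at hJp

/-- **Lemma 2.2.** For `1 < p < ∞` and a differentiable increasing `g : ℝ → ℝ`
(`g'(s) ≥ 0` for all `s`), with `G(t) = ∫₀^t (g'(s))^{1/p} ds`, one has
`|a − b|^{p−2}(a − b)(g(a) − g(b)) ≥ |G(a) − G(b)|^p` for all `a b : ℝ`.
Here `x ^ y` is the real power, so `|t|^{p-2} t = 0` when `t = 0`. -/
theorem brasco_parini_increasing_inequality
    (p : ℝ) (hp : 1 < p)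
    (g : ℝ → ℝ) (hdiff : Differentiable ℝ g) (hincr : ∀ s : ℝ, 0 ≤ deriv g s)
    (G : ℝ → ℝ) (hG : ∀ t : ℝ, G t = ∫ s in (0 : ℝ)..t, (deriv g s) ^ ((1 : ℝ) / p))
    (a b : ℝ) :
    |G a - G b| ^ p ≤ |a - b| ^ (p - 2) * (a - b) * (g a - g b) := by
  have hp0 : 0 < p := by linarith
  have hint := intervalIntegrable_deriv_of_deriv_nonneg hdiff hincr
  have key : ∀ x y : ℝ, x < y →
      |G y - G x| ^ p ≤ |y - x| ^ (p - 2) * (y - x) * (g y - g x) := by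
    intro x y hxy
    have hL : 0 < y - x := sub_pos.2 hxy
    have hroot (u v : ℝ) := (hint u v).rpow_of_nonneg hincr (r := 1 / p) (by positivity)
      (by rw [div_le_one hp0]; exact hp.le)
    have hI : 0 ≤ ∫ s in x..y, deriv g s ^ (1 / p) :=
      intervalIntegral.integral_nonneg hxy.le fun s _ => Real.rpow_nonneg (hincr s) _
    have h := integral_rpow_one_div_rpow_le hp hxy (hint x y) hincr
    rw [intervalIntegral.integral_deriv_eq_sub (fun s _ => hdiff s) (hint x y)] at h
    rw [hG y, hG x, intervalIntegral.integral_interval_sub_left (hroot 0 y) (hroot 0 x),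
      abs_of_nonneg hI, abs_of_pos hL, ← Real.rpow_add_one hL.ne',
      show p - 2 + 1 = p - 1 by ring]
    exact h
  rcases lt_trichotomy a b with h | rfl | h
  · have h' := key a b h
    rw [abs_sub_comm (G b), abs_sub_comm b] at h'
    linarith
  · simp [Real.zero_rpow hp0.ne']
  · exact key b a h
end
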